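/- Let $0<p<1$ and $c\in\mathbb{R}$, and let $R^N_c=\{x\in\mathbb{R}^N: x_N>c\}$ be a half-space. Then there is no bounded nontrivial $C^2$ solution of $-\Delta u=u^p$, $u\geq 0$ in $R^N_c$ with $u=0$ on $\{x_N=c\}$. -/

import Mathlib

open Real

/-- The Laplacian of `u : ℝ^N → ℝ`, as the sum of second partial derivatives. -/
noncomputable def lap {N : ℕ} (u : EuclideanSpace ℝ (Fin N) → ℝ)
    (x : EuclideanSpace ℝ (Fin N)) : ℝ :=
  ∑ i : Fin N, fderiv ℝ (fun y => fderiv ℝ u y (EuclideanSpace.single i 1)) x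
    (EuclideanSpace.single i 1)

/-- Second-order necessary condition for a local minimum on the line. -/
theorem IsLocalMin.nonneg_of_hasDerivAt_hasDerivAt {f f' : ℝ → ℝ} {t a : ℝ}
    (hmin : IsLocalMin f t) (hf : ∀ᶠ s in nhds t, HasDerivAt f (f' s) s)
    (hf' : HasDerivAt f' a t) : 0 ≤ a := by
  by_contra! ha
  have hderiv : deriv f =ᶠ[nhds t] f' := hf.mono fun s hs => hs.deriv
  have hdd : deriv (deriv f) t = a := hderiv.deriv_eq.trans hf'.deriv
  have hmax : IsLocalMax f t :=
    isLocalMax_of_deriv_deriv_neg (by rwa [hdd]) hmin.deriv_eq_zero hf.self_of_nhds.continuousAt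
  have hconst : f =ᶠ[nhds t] fun _ => f t := by
    filter_upwards [hmin, hmax] with s h1 h2 using le_antisymm h2 h1
  have hzero : deriv f =ᶠ[nhds t] fun _ => 0 := by
    simpa using hconst.deriv
  have : deriv (deriv f) t = 0 := by simpa using hzero.deriv_eq
  linarith

/-- If `u - φ` has a local minimum at `x`, then the Laplacian of `φ`, computed along coordinate
lines, is at most that of `u`. -/
theorem sum_le_lap_of_isLocalMin {n : ℕ} {u φ : EuclideanSpace ℝ (Fin n) → ℝ}
    {x : EuclideanSpace ℝ (Fin n)} (hu : ContDiffAt ℝ 2 u x) {g : Fin n → ℝ → ℝ} {a : Fin n → ℝ}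
    (hg : ∀ i t, HasDerivAt (fun s : ℝ => φ (x + s • EuclideanSpace.single i 1)) (g i t) t)
    (hga : ∀ i, HasDerivAt (g i) (a i) 0)
    (hmin : IsLocalMin (fun y => u y - φ y) x) : ∑ i, a i ≤ lap u x := by
  refine Finset.sum_le_sum fun i _ => ?_
  set e : EuclideanSpace ℝ (Fin n) := EuclideanSpace.single i 1
  have hline (t : ℝ) : HasDerivAt (fun s : ℝ => x + s • e) e t := by
    simpa using ((hasDerivAt_id t).smul_const e).const_add x
  have htend : Filter.Tendsto (fun s : ℝ => x + s • e) (nhds 0) (nhds x) := by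
    simpa using (hline 0).continuousAt.tendsto
  have hdiff : ∀ᶠ y in nhds x, DifferentiableAt ℝ u y :=
    (hu.eventually (by simp)).mono fun y hy => hy.differentiableAt (by simp)
  have hfd : DifferentiableAt ℝ (fun y => fderiv ℝ u y e) x :=
    ((hu.fderiv_right (m := 1) (by norm_num)).differentiableAt (by simp)).clm_apply
      (differentiableAt_const e)
  have hfirst : ∀ᶠ t in nhds (0 : ℝ), HasDerivAt (fun s : ℝ => u (x + s • e) - φ (x + s • e))
      (fderiv ℝ u (x + t • e) e - g i t) t := by
    filter_upwards [htend.eventually hdiff] with t ht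
    exact (ht.hasFDerivAt.comp_hasDerivAt t (hline t)).sub (hg i t)
  have hsecond : HasDerivAt (fun t : ℝ => fderiv ℝ u (x + t • e) e - g i t)
      (fderiv ℝ (fun y => fderiv ℝ u y e) x e - a i) 0 := by
    refine HasDerivAt.sub ?_ (hga i)
    have h0 : x + (0 : ℝ) • e = x := by simp
    have h1 : HasFDerivAt (fun y => fderiv ℝ u y e) (fderiv ℝ (fun y => fderiv ℝ u y e) x)
        (x + (0 : ℝ) • e) := by
      rw [h0]; exact hfd.hasFDerivAt
    exact h1.comp_hasDerivAt 0 (hline 0)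
  have hmin' : IsLocalMin (fun s : ℝ => u (x + s • e) - φ (x + s • e)) 0 := by
    have := htend.eventually hmin
    simpa [IsLocalMin, IsMinFilter] using this
  linarith [hmin'.nonneg_of_hasDerivAt_hasDerivAt hfirst hsecond]

/-- Comparison of the Laplacian of `u` with that of the radial barrier
`C * (R ^ 2 - ‖y - z‖ ^ 2) ^ (m + 2)` at a point where `u` minus the barrier is locally minimal. -/
theorem barrier_le_lap_of_isLocalMin {n : ℕ} {u : EuclideanSpace ℝ (Fin n) → ℝ}
    {x z : EuclideanSpace ℝ (Fin n)} (hu : ContDiffAt ℝ 2 u x) (C R : ℝ) (m : ℕ)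
    (hmin : IsLocalMin (fun y => u y - C * (R ^ 2 - ‖y - z‖ ^ 2) ^ (m + 2)) x) :
    C * ((m + 2) * (R ^ 2 - ‖x - z‖ ^ 2) ^ m *
      (4 * (m + 1) * ‖x - z‖ ^ 2 - 2 * n * (R ^ 2 - ‖x - z‖ ^ 2))) ≤ lap u x := by
  set q := R ^ 2 - ‖x - z‖ ^ 2 with hq
  have hexp (i : Fin n) (t : ℝ) :
      R ^ 2 - ‖x + t • EuclideanSpace.single i (1 : ℝ) - z‖ ^ 2 =
        q - 2 * t * (x - z) i - t ^ 2 := by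
    rw [add_sub_right_comm, norm_add_sq_real, inner_smul_right, norm_smul,
      EuclideanSpace.inner_single_right, PiLp.norm_single]
    simp [hq]
    ring
  have hq' (i : Fin n) (t : ℝ) : HasDerivAt (fun t : ℝ => q - 2 * t * (x - z) i - t ^ 2)
      (-2 * (x - z) i - 2 * t) t := by
    have h := (((hasDerivAt_id' t).const_mul 2).mul_const ((x - z) i)).const_sub q |>.fun_sub
      (hasDerivAt_pow 2 t)
    exact h.congr_deriv (by simp)
  have key := sum_le_lap_of_isLocalMin (u := u) hu
    (φ := fun y => C * (R ^ 2 - ‖y - z‖ ^ 2) ^ (m + 2))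
    (g := fun i t => C * ((m + 2) * (q - 2 * t * (x - z) i - t ^ 2) ^ (m + 1) *
      (-2 * (x - z) i - 2 * t)))
    (a := fun i => C * ((m + 2) * ((m + 1) * q ^ m * (4 * (x - z) i ^ 2) - 2 * q ^ (m + 1))))
    (fun i t => by
      simp only [hexp]
      exact (((hq' i t).fun_pow (m + 2)).const_mul C).congr_deriv (by simp))
    (fun i => by
      have hl : HasDerivAt (fun t : ℝ => -2 * (x - z) i - 2 * t) (-2) 0 := by
        simpa using ((hasDerivAt_id (0 : ℝ)).const_mul 2).const_sub (-2 * (x - z) i)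
      refine (((((hq' i 0).fun_pow (m + 1)).const_mul ((m : ℝ) + 2)).fun_mul hl).const_mul
        C).congr_deriv ?_
      simp [-mul_eq_mul_left_iff]
      ring)
    hmin
  refine le_trans (le_of_eq ?_) key
  have hn : ‖x - z‖ ^ 2 = ∑ i, (x - z) i ^ 2 := EuclideanSpace.real_norm_sq_eq _
  rw [← Finset.mul_sum, ← Finset.mul_sum, Finset.sum_sub_distrib, ← Finset.mul_sum,
    ← Finset.mul_sum, ← hn, Finset.sum_const, Finset.card_univ, Fintype.card_fin, nsmul_eq_mul]
  ring

/-- A nonnegative superharmonic function which is positive at the centre of a closed ball is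
positive in the whole open ball. -/
theorem pos_of_lap_nonpos_of_pos_center {n : ℕ} {u : EuclideanSpace ℝ (Fin n) → ℝ}
    {z y : EuclideanSpace ℝ (Fin n)} {R : ℝ}
    (hu : ∀ x ∈ Metric.closedBall z R, ContDiffAt ℝ 2 u x)
    (hnonneg : ∀ x ∈ Metric.closedBall z R, 0 ≤ u x)
    (hlap : ∀ x ∈ Metric.closedBall z R, lap u x ≤ 0)
    (hz : 0 < u z) (hy : y ∈ Metric.ball z R) : 0 < u y := by
  have hR : 0 < R := Metric.pos_of_mem_ball hy
  have hcont : ContinuousOn u (Metric.closedBall z R) :=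
    fun x hx => (hu x hx).continuousAt.continuousWithinAt
  obtain ⟨r, hr, hball⟩ := Metric.eventually_nhds_iff_ball.1
    ((hu z (Metric.mem_closedBall_self hR.le)).continuousAt.eventually_const_lt (half_lt_self hz))
  obtain ⟨m, hm⟩ := exists_nat_gt (n * R ^ 2 / r ^ 2)
  rw [div_lt_iff₀ (by positivity)] at hm
  set C := u z / 2 / (R ^ 2) ^ (m + 2) with hCdef
  have hC : 0 < C := by positivity
  have hq0 {x : EuclideanSpace ℝ (Fin n)} (hx : x ∈ Metric.closedBall z R) :
      0 ≤ R ^ 2 - ‖x - z‖ ^ 2 := by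
    rw [mem_closedBall_iff_norm] at hx
    nlinarith [norm_nonneg (x - z)]
  obtain ⟨x, hx, hxmin⟩ := (isCompact_closedBall z R).exists_isMinOn
    ⟨z, Metric.mem_closedBall_self hR.le⟩
    (f := fun y => u y - C * (R ^ 2 - ‖y - z‖ ^ 2) ^ (m + 2)) (by fun_prop)
  have hbarrier : 0 ≤ u x - C * (R ^ 2 - ‖x - z‖ ^ 2) ^ (m + 2) := by
    by_contra! hneg
    have hxR : ‖x - z‖ < R := by
      refine lt_of_le_of_ne (mem_closedBall_iff_norm.1 hx) fun h => ?_
      rw [h] at hneg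
      simp at hneg
      linarith [hnonneg x hx]
    have hxr : r ≤ ‖x - z‖ := by
      by_contra! h
      have h1 := hball x (mem_ball_iff_norm.2 h)
      have h2 : C * (R ^ 2 - ‖x - z‖ ^ 2) ^ (m + 2) ≤ C * (R ^ 2) ^ (m + 2) := by
        have := hq0 hx
        gcongr
        linarith [sq_nonneg ‖x - z‖]
      have h3 : C * (R ^ 2) ^ (m + 2) = u z / 2 := by
        rw [hCdef]; field_simp
      linarith
    have hloc : IsLocalMin (fun y => u y - C * (R ^ 2 - ‖y - z‖ ^ 2) ^ (m + 2)) x :=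
      hxmin.isLocalMin (Metric.closedBall_mem_nhds_of_mem (mem_ball_iff_norm.2 hxR))
    have h1 := (barrier_le_lap_of_isLocalMin (hu x hx) C R m hloc).trans (hlap x hx)
    have hq : 0 < R ^ 2 - ‖x - z‖ ^ 2 := by nlinarith [norm_nonneg (x - z)]
    have hs : r ^ 2 ≤ ‖x - z‖ ^ 2 := by gcongr
    have h2 : 0 < 4 * (m + 1) * ‖x - z‖ ^ 2 - 2 * n * (R ^ 2 - ‖x - z‖ ^ 2) := by
      have e1 : (m : ℝ) * r ^ 2 ≤ m * ‖x - z‖ ^ 2 := by gcongr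
      have e2 : 0 ≤ (n : ℝ) * ‖x - z‖ ^ 2 := by positivity
      have e3 : 0 ≤ (m : ℝ) * ‖x - z‖ ^ 2 := by positivity
      nlinarith [pow_pos hr 2]
    have : 0 < C * ((m + 2) * (R ^ 2 - ‖x - z‖ ^ 2) ^ m *
      (4 * (m + 1) * ‖x - z‖ ^ 2 - 2 * n * (R ^ 2 - ‖x - z‖ ^ 2))) := by positivity
    linarith
  have hyx := hxmin (Metric.ball_subset_closedBall hy)
  have hqy : 0 < R ^ 2 - ‖y - z‖ ^ 2 := by
    have := mem_ball_iff_norm.1 hy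
    nlinarith [norm_nonneg (y - z)]
  have : 0 < C * (R ^ 2 - ‖y - z‖ ^ 2) ^ (m + 2) := by positivity
  simp only [Set.mem_ofPred_eq] at hyx
  linarith

/-- Strong maximum principle: on a connected open set, a nonnegative superharmonic function which
is positive at one point is positive everywhere. -/
theorem pos_of_lap_nonpos {n : ℕ} {u : EuclideanSpace ℝ (Fin n) → ℝ}
    {H : Set (EuclideanSpace ℝ (Fin n))} (hopen : IsOpen H) (hconn : IsPreconnected H)
    (hu : ∀ x ∈ H, ContDiffAt ℝ 2 u x) (hnonneg : ∀ x ∈ H, 0 ≤ u x)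
    (hlap : ∀ x ∈ H, lap u x ≤ 0) {x₀ : EuclideanSpace ℝ (Fin n)} (hx₀ : x₀ ∈ H)
    (hpos : 0 < u x₀) : ∀ x ∈ H, 0 < u x := by
  have hcont : ContinuousOn u H := fun x hx => (hu x hx).continuousAt.continuousWithinAt
  have hUopen : IsOpen (H ∩ u ⁻¹' Set.Ioi 0) := hcont.isOpen_inter_preimage hopen isOpen_Ioi
  have hsub : H ⊆ H ∩ u ⁻¹' Set.Ioi 0 := by
    refine hconn.subset_of_closure_inter_subset hUopen ⟨x₀, hx₀, hx₀, hpos⟩ ?_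
    rintro y ⟨hycl, hyH⟩
    obtain ⟨δ, hδ, hball⟩ := Metric.isOpen_iff.1 hopen y hyH
    obtain ⟨z, ⟨-, hzpos⟩, hyz⟩ := Metric.mem_closure_iff.1 hycl (δ / 3) (by positivity)
    have hin : Metric.closedBall z (δ / 2) ⊆ H := fun w hw => hball <| by
      rw [Metric.mem_closedBall] at hw
      rw [Metric.mem_ball]
      linarith [dist_triangle w z y, dist_comm y z]
    refine ⟨hyH, pos_of_lap_nonpos_of_pos_center (fun x hx => hu x (hin hx))
      (fun x hx => hnonneg x (hin hx)) (fun x hx => hlap x (hin hx)) hzpos (R := δ / 2) ?_⟩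
    rw [Metric.mem_ball]
    linarith
  exact fun x hx => (hsub hx).2

/-- There is no positive solution of `lap u ≤ -k * u` on a sufficiently large closed ball. -/
theorem not_lap_le_neg_mul {n : ℕ} {u : EuclideanSpace ℝ (Fin n) → ℝ}
    {z : EuclideanSpace ℝ (Fin n)} {k R : ℝ} (hk : 0 < k) (hR : 0 < R)
    (hkR : (n + 2) ^ 2 < 2 * k * R ^ 2)
    (hu : ∀ x ∈ Metric.closedBall z R, ContDiffAt ℝ 2 u x)
    (hpos : ∀ x ∈ Metric.closedBall z R, 0 < u x) :
    ¬ ∀ x ∈ Metric.closedBall z R, lap u x ≤ -(k * u x) := by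
  intro hlap
  have hcont : ContinuousOn u (Metric.closedBall z R) :=
    fun x hx => (hu x hx).continuousAt.continuousWithinAt
  have hzmem : z ∈ Metric.closedBall z R := Metric.mem_closedBall_self hR.le
  obtain ⟨x, hx, hxmax⟩ := (isCompact_closedBall z R).exists_isMaxOn ⟨z, hzmem⟩
    (f := fun y => (R ^ 2 - ‖y - z‖ ^ 2) ^ 2 / u y)
    (ContinuousOn.div (by fun_prop) hcont fun y hy => (hpos y hy).ne')
  set S := (R ^ 2 - ‖x - z‖ ^ 2) ^ 2 / u x with hS
  have hux := hpos x hx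
  have hSpos : 0 < S := by
    have h : (R ^ 2 - ‖z - z‖ ^ 2) ^ 2 / u z ≤ S := hxmax hzmem
    refine lt_of_lt_of_le ?_ h
    have := hpos z hzmem
    have : 0 < R ^ 2 - ‖z - z‖ ^ 2 := by simpa using pow_pos hR 2
    positivity
  have hxR : ‖x - z‖ < R := by
    refine lt_of_le_of_ne (mem_closedBall_iff_norm.1 hx) fun h => ?_
    rw [hS, h] at hSpos
    simp at hSpos
  have hq : 0 < R ^ 2 - ‖x - z‖ ^ 2 := by nlinarith [norm_nonneg (x - z)]
  have hSu : S⁻¹ * (R ^ 2 - ‖x - z‖ ^ 2) ^ 2 = u x := by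
    rw [hS]; field_simp
  have hmin : IsMinOn (fun y => u y - S⁻¹ * (R ^ 2 - ‖y - z‖ ^ 2) ^ (0 + 2))
      (Metric.closedBall z R) x := by
    intro y hy
    have h : (R ^ 2 - ‖y - z‖ ^ 2) ^ 2 / u y ≤ S := hxmax hy
    rw [div_le_iff₀ (hpos y hy)] at h
    have h' : S⁻¹ * (R ^ 2 - ‖y - z‖ ^ 2) ^ 2 ≤ u y := by
      rwa [inv_mul_le_iff₀ hSpos]
    simp only [Set.mem_ofPred_eq, zero_add, hSu]
    linarith
  have h := (barrier_le_lap_of_isLocalMin (hu x hx) S⁻¹ R 0 (hmin.isLocalMin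
    (Metric.closedBall_mem_nhds_of_mem (mem_ball_iff_norm.2 hxR)))).trans (hlap x hx)
  rw [← hSu] at h
  set q := R ^ 2 - ‖x - z‖ ^ 2 with hqdef
  have hs : ‖x - z‖ ^ 2 = R ^ 2 - q := by rw [hqdef]; ring
  rw [hs] at h
  have h2 : S⁻¹ * (8 * (R ^ 2 - q) - 4 * n * q + k * q ^ 2) ≤ 0 := by
    norm_num at h
    linarith
  have h3 : 0 < 8 * (R ^ 2 - q) - 4 * n * q + k * q ^ 2 := by
    have e : k * (8 * (R ^ 2 - q) - 4 * n * q + k * q ^ 2) =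
        (k * q - 2 * (n + 2)) ^ 2 + 4 * (2 * k * R ^ 2 - (n + 2) ^ 2) := by ring
    refine pos_of_mul_pos_right (a := k) ?_ hk.le
    rw [e]
    nlinarith [sq_nonneg (k * q - 2 * (n + 2))]
  have : 0 < S⁻¹ * (8 * (R ^ 2 - q) - 4 * n * q + k * q ^ 2) := by positivity
  linarith

theorem stmt11 (N : ℕ) (p c : ℝ) (hp0 : 0 < p) (hp1 : p < 1)
    (H : Set (EuclideanSpace ℝ (Fin (N + 1))))
    (hH : H = {x : EuclideanSpace ℝ (Fin (N + 1)) | c < x (Fin.last N)})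
    (u : EuclideanSpace ℝ (Fin (N + 1)) → ℝ)
    (hreg : ContDiffOn ℝ 2 u (closure H))
    (hnonneg : ∀ x ∈ closure H, 0 ≤ u x)
    (hbdd : ∃ M : ℝ, ∀ x ∈ closure H, u x ≤ M)
    (heq : ∀ x ∈ H, -(lap u x) = (u x) ^ p)
    (hbc : ∀ x : EuclideanSpace ℝ (Fin (N + 1)), x (Fin.last N) = c → u x = 0) :
    ∀ x ∈ H, u x = 0 := by
  obtain ⟨M, hM⟩ := hbdd
  have hopen : IsOpen H := by
    rw [hH]
    exact isOpen_lt continuous_const (by fun_prop)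
  have hconv : Convex ℝ H := by
    rw [hH]
    exact convex_halfSpace_gt
      (EuclideanSpace.proj (𝕜 := ℝ) (Fin.last N)).toLinearMap.isLinear c
  have hu : ∀ x ∈ H, ContDiffAt ℝ 2 u x := fun x hx =>
    hreg.contDiffAt (Filter.mem_of_superset (hopen.mem_nhds hx) subset_closure)
  have hlap : ∀ x ∈ H, lap u x ≤ 0 := fun x hx => by
    have := heq x hx
    have := Real.rpow_nonneg (hnonneg x (subset_closure hx)) p
    linarith
  by_contra! hne
  obtain ⟨x₀, hx₀, hne⟩ := hne
  have hpos₀ : 0 < u x₀ := lt_of_le_of_ne (hnonneg x₀ (subset_closure hx₀)) hne.symm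
  have hpos := pos_of_lap_nonpos hopen hconv.isPreconnected hu
    (fun x hx => hnonneg x (subset_closure hx)) hlap hx₀ hpos₀
  have hM0 : 0 < M := hpos₀.trans_le (hM x₀ (subset_closure hx₀))
  set k := M ^ (p - 1)
  have hk : 0 < k := Real.rpow_pos_of_pos hM0 _
  obtain ⟨R, hR, hkR⟩ : ∃ R : ℝ, 0 < R ∧ (((N + 1 : ℕ) : ℝ) + 2) ^ 2 < 2 * k * R ^ 2 := by
    refine ⟨(((N + 1 : ℕ) : ℝ) + 2) / √k, by positivity, ?_⟩
    have h : 2 * k * ((((N + 1 : ℕ) : ℝ) + 2) / √k) ^ 2 = 2 * (((N + 1 : ℕ) : ℝ) + 2) ^ 2 := by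
      rw [div_pow, Real.sq_sqrt hk.le]
      field_simp
    rw [h]
    have : 0 < (((N + 1 : ℕ) : ℝ) + 2) ^ 2 := by positivity
    linarith
  set z : EuclideanSpace ℝ (Fin (N + 1)) := EuclideanSpace.single (Fin.last N) (c + R + 1)
  have hin : Metric.closedBall z R ⊆ H := fun x hx => by
    rw [mem_closedBall_iff_norm] at hx
    have h1 := (PiLp.norm_apply_le (x - z) (Fin.last N)).trans hx
    have hz : z (Fin.last N) = c + R + 1 := by simp [z]
    rw [PiLp.sub_apply, hz, Real.norm_eq_abs] at h1
    rw [hH, Set.mem_ofPred_eq]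
    linarith [(abs_le.1 h1).1]
  refine not_lap_le_neg_mul hk hR hkR (fun x hx => hu x (hin hx)) (fun x hx => hpos x (hin hx))
    fun x hx => ?_
  have hux := hpos x (hin hx)
  have h1 : k ≤ u x ^ (p - 1) :=
    Real.rpow_le_rpow_of_nonpos hux (hM x (subset_closure (hin hx))) (by linarith)
  have h2 : u x ^ p = u x ^ (p - 1) * u x := by
    rw [Real.rpow_sub_one hux.ne', div_mul_cancel₀ _ hux.ne']
  have h3 : k * u x ≤ u x ^ (p - 1) * u x := by gcongr
  linarith [heq x (hin hx)]
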